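/- arXiv:2109.09610 — 7 statements merged into one kernel-verified Lean document; each statement's English description precedes it below -/
import Mathlib

section
/- Implicit-differentiation formula for the lower-level minimizer: let Γ := EuclideanSpace ℝ (Fin P) and X := EuclideanSpace ℝ (Fin N), let Φ : Γ × X → ℝ be twice continuously differentiable (ContDiff ℝ 2), and let x̂ : Γ → X be differentiable with the stationarity property that for every γ, the gradient of x ↦ Φ(γ, x) vanishes at x̂(γ). Fix γ and let g(γ', x) denote the gradient of x' ↦ Φ(γ', x') at x. If the continuous linear map H := fderiv ℝ (fun x => g(γ, x)) (x̂ γ) : X →L[ℝ] X is invertible, say H = e.toContinuousLinearMap for a continuous linear equivalence e : X ≃L[ℝ] X, then fderiv ℝ x̂ γ = -(e.symm.toContinuousLinearMap ∘L J), where J := fderiv ℝ (fun γ' => g(γ', x̂ γ)) γ : Γ →L[ℝ] X. -/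
section

variable {E F G : Type*} [NormedAddCommGroup E] [NormedSpace ℝ E]

/-- The Riesz representation of a real Hilbert space is real linear and bounded. -/
theorem isBoundedLinearMap_toDual_symm [NormedAddCommGroup F] [InnerProductSpace ℝ F]
    [CompleteSpace F] :
    IsBoundedLinearMap ℝ (fun l : StrongDual ℝ F => (InnerProductSpace.toDual ℝ F).symm l) where
  map_add := map_add _
  map_smul c l := by simp
  bound := ⟨1, one_pos, fun l => by simp⟩

/-- The partial gradient of a `C²` function on a product is jointly differentiable. -/
theorem ContDiff.differentiable_partial_gradient [NormedAddCommGroup F] [InnerProductSpace ℝ F]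
    [CompleteSpace F] {Φ : E × F → ℝ} (hΦ : ContDiff ℝ 2 Φ) :
    Differentiable ℝ (fun p : E × F => gradient (fun x => Φ (p.1, x)) p.2) := by
  have hpartial (p : E × F) : fderiv ℝ (fun x => Φ (p.1, x)) p.2 =
      (fderiv ℝ Φ p).comp (ContinuousLinearMap.inr ℝ E F) :=
    ((hΦ.differentiable two_ne_zero p).hasFDerivAt.comp p.2
      (hasFDerivAt_prodMk_right p.1 p.2)).fderiv
  simp only [gradient, hpartial]
  have hfderiv : Differentiable ℝ (fderiv ℝ Φ) :=
    (hΦ.fderiv_right (m := 1) (by norm_num)).differentiable one_ne_zero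
  exact isBoundedLinearMap_toDual_symm.differentiable.comp
    (hfderiv.clm_comp (differentiable_const _))

/-- Differentiating the identity `f (t, x t) = 0` when the partial derivative of `f` in its second
argument is invertible. -/
theorem fderiv_eq_neg_symm_comp_of_eq_zero [NormedAddCommGroup F] [NormedSpace ℝ F]
    [NormedAddCommGroup G] [NormedSpace ℝ G] {f : E × F → G} {x : E → F} {t : E}
    (hf : DifferentiableAt ℝ f (t, x t)) (hx : DifferentiableAt ℝ x t)
    (hzero : ∀ s, f (s, x s) = 0) (e : F ≃L[ℝ] G)
    (he : fderiv ℝ (fun y => f (t, y)) (x t) = (e : F →L[ℝ] G)) :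
    fderiv ℝ x t =
      -((e.symm : G →L[ℝ] F).comp (fderiv ℝ (fun s => f (s, x t)) t)) := by
  have hleft : fderiv ℝ (fun s => f (s, x t)) t =
      (fderiv ℝ f (t, x t)).comp (ContinuousLinearMap.inl ℝ E F) :=
    (hf.hasFDerivAt.comp t (hasFDerivAt_prodMk_left t (x t))).fderiv
  have hright : fderiv ℝ (fun y => f (t, y)) (x t) =
      (fderiv ℝ f (t, x t)).comp (ContinuousLinearMap.inr ℝ E F) :=
    (hf.hasFDerivAt.comp (x t) (hasFDerivAt_prodMk_right t (x t))).fderiv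
  have htotal : (fderiv ℝ f (t, x t)).comp
      ((ContinuousLinearMap.id ℝ E).prod (fderiv ℝ x t)) = 0 := by
    have h := hf.hasFDerivAt.comp t ((hasFDerivAt_id t).prodMk hx.hasFDerivAt)
    refine h.unique ?_
    have hconst : f ∘ (fun s => (id s, x s)) = fun _ => 0 := funext hzero
    rw [hconst]
    exact hasFDerivAt_const 0 t
  ext v
  have hv : fderiv ℝ f (t, x t) (v, 0) + e (fderiv ℝ x t v) = 0 := by
    have h1 := DFunLike.congr_fun htotal v
    have h2 := DFunLike.congr_fun (he.symm.trans hright) (fderiv ℝ x t v)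
    simp only [ContinuousLinearMap.comp_apply, ContinuousLinearMap.inr_apply,
      ContinuousLinearEquiv.coe_coe] at h2
    rw [h2, ← map_add]
    simpa using h1
  rw [hleft]
  apply e.injective
  simpa using eq_neg_of_add_eq_zero_right hv

end

/-- Implicit-differentiation formula for the lower-level minimizer. -/
theorem stmt_0 (P N : ℕ) (hP : 0 < P) (hN : 0 < N)
    (Φ : EuclideanSpace ℝ (Fin P) × EuclideanSpace ℝ (Fin N) → ℝ)
    (hΦ : ContDiff ℝ 2 Φ)
    (xhat : EuclideanSpace ℝ (Fin P) → EuclideanSpace ℝ (Fin N))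
    (hxhat : Differentiable ℝ xhat)
    (hstat : ∀ γ : EuclideanSpace ℝ (Fin P),
      gradient (fun x => Φ (γ, x)) (xhat γ) = 0)
    (γ : EuclideanSpace ℝ (Fin P))
    (g : EuclideanSpace ℝ (Fin P) → EuclideanSpace ℝ (Fin N) → EuclideanSpace ℝ (Fin N))
    (hg : ∀ γ' x, g γ' x = gradient (fun x' => Φ (γ', x')) x)
    (e : EuclideanSpace ℝ (Fin N) ≃L[ℝ] EuclideanSpace ℝ (Fin N))
    (hH : fderiv ℝ (fun x => g γ x) (xhat γ) =
      (e : EuclideanSpace ℝ (Fin N) →L[ℝ] EuclideanSpace ℝ (Fin N))) :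
    fderiv ℝ xhat γ =
      -((e.symm : EuclideanSpace ℝ (Fin N) →L[ℝ] EuclideanSpace ℝ (Fin N)).comp
          (fderiv ℝ (fun γ' => g γ' (xhat γ)) γ)) := by
  obtain rfl : g = fun γ' x => gradient (fun x' => Φ (γ', x')) x :=
    funext fun γ' => funext fun x => hg γ' x
  exact fderiv_eq_neg_symm_comp_of_eq_zero
    (f := fun p => gradient (fun x' => Φ (p.1, x')) p.2)
    (hΦ.differentiable_partial_gradient _) (hxhat γ) hstat e hH
end

section
/- Gradient of the upper-level loss via the minimizer approach: let Γ := EuclideanSpace ℝ (Fin P) and X := EuclideanSpace ℝ (Fin N), let Φ : Γ × X → ℝ be twice continuously differentiable, let ℓ : Γ × X → ℝ be differentiable, and let x̂ : Γ → X be differentiable with the gradient of x ↦ Φ(γ, x) vanishing at x̂(γ) for every γ. Fix γ, write g(γ', x) for the gradient of x' ↦ Φ(γ', x') at x, set H := fderiv ℝ (fun x => g(γ, x)) (x̂ γ) and J := fderiv ℝ (fun γ' => g(γ', x̂ γ)) γ, and assume H is invertible with inverse H⁻¹ (given by a continuous linear equivalence). Then the gradient at γ of the reduced loss γ' ↦ ℓ(γ',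 x̂ γ') equals (gradient of γ' ↦ ℓ(γ', x̂ γ) at γ) - (ContinuousLinearMap.adjoint J) (H⁻¹ (gradient of x ↦ ℓ(γ, x) at x̂ γ)). -/
/-- Total derivative of `y ↦ f (y, u y)` as a sum of partial derivatives. -/
theorem fderiv_comp_graph_apply {E F G : Type*} [NormedAddCommGroup E] [NormedSpace ℝ E]
    [NormedAddCommGroup F] [NormedSpace ℝ F] [NormedAddCommGroup G] [NormedSpace ℝ G]
    {f : E × F → G} {u : E → F} {y : E}
    (hf : DifferentiableAt ℝ f (y, u y)) (hu : DifferentiableAt ℝ u y) (v : E) :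
    fderiv ℝ (fun y' => f (y', u y')) y v =
      fderiv ℝ (fun y' => f (y', u y)) y v +
        fderiv ℝ (fun x => f (y, x)) (u y) (fderiv ℝ u y v) := by
  have h1 : HasFDerivAt (fun y' => f (y', u y')) _ y :=
    HasFDerivAt.comp (g := f) y hf.hasFDerivAt ((hasFDerivAt_id y).prodMk hu.hasFDerivAt)
  have h2 : HasFDerivAt (fun y' => f (y', u y)) _ y :=
    HasFDerivAt.comp (g := f) y hf.hasFDerivAt (hasFDerivAt_prodMk_left y (u y))
  have h3 : HasFDerivAt (fun x => f (y, x)) _ (u y) :=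
    HasFDerivAt.comp (g := f) (u y) hf.hasFDerivAt (hasFDerivAt_prodMk_right y (u y))
  rw [h1.fderiv, h2.fderiv, h3.fderiv]
  simp [← map_add]

section PartialGradient

variable {E F : Type*} [NormedAddCommGroup E] [NormedSpace ℝ E]
  [NormedAddCommGroup F] [InnerProductSpace ℝ F] [CompleteSpace F]

/-- The gradient in the second variable, expressed through the full Fréchet derivative. -/
theorem gradient_snd_eq_toDual_symm {Φ : E × F → ℝ} {p : E × F} (hΦ : DifferentiableAt ℝ Φ p) :
    gradient (fun x => Φ (p.1, x)) p.2 =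
      (InnerProductSpace.toDual ℝ F).symm
        ((fderiv ℝ Φ p).comp (ContinuousLinearMap.inr ℝ E F)) := by
  have h : HasFDerivAt (fun x => Φ (p.1, x))
      ((fderiv ℝ Φ p).comp (ContinuousLinearMap.inr ℝ E F)) p.2 :=
    HasFDerivAt.comp (g := Φ) p.2 hΦ.hasFDerivAt (hasFDerivAt_prodMk_right p.1 p.2)
  rw [gradient, h.fderiv]

/-- The partial gradient of a `C^2` function is differentiable. -/
theorem ContDiff.differentiable_gradient_snd {Φ : E × F → ℝ} (hΦ : ContDiff ℝ 2 Φ) :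
    Differentiable ℝ (fun p : E × F => gradient (fun x => Φ (p.1, x)) p.2) := by
  have h1 : Differentiable ℝ (fderiv ℝ Φ) :=
    (hΦ.fderiv_right (m := 1) (by norm_num)).differentiable (by norm_num)
  have h2 : (fun p : E × F => gradient (fun x => Φ (p.1, x)) p.2) = fun p =>
      (InnerProductSpace.toDual ℝ F).symm
        ((fderiv ℝ Φ p).comp (ContinuousLinearMap.inr ℝ E F)) :=
    funext fun p => gradient_snd_eq_toDual_symm (hΦ.differentiable (by norm_num) p)
  rw [h2]
  exact (InnerProductSpace.toDual ℝ F).symm.toContinuousLinearEquiv.differentiable.comp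
    (h1.clm_comp (differentiable_const _))

/-- The Hessian of a `C^2` function is symmetric. -/
theorem inner_fderiv_gradient_comm {f : F → ℝ} (hf : ContDiff ℝ 2 f) (x v w : F) :
    inner ℝ (fderiv ℝ (gradient f) x v) w = inner ℝ v (fderiv ℝ (gradient f) x w) := by
  have h1 : DifferentiableAt ℝ (fderiv ℝ f) x :=
    (hf.fderiv_right (m := 1) (by norm_num)).differentiable (by norm_num) x
  have h2 : DifferentiableAt ℝ (gradient f) x :=
    (InnerProductSpace.toDual ℝ F).symm.toContinuousLinearEquiv.differentiable.differentiableAt.comp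
      x h1
  have hsymm : fderiv ℝ (fderiv ℝ f) x v w = fderiv ℝ (fderiv ℝ f) x w v :=
    (hf.contDiffAt.isSymmSndFDerivAt (by simp)) v w
  have key (a b : F) :
      inner ℝ (fderiv ℝ (gradient f) x a) b = fderiv ℝ (fderiv ℝ f) x a b := by
    have h3 : (fun y => inner ℝ (gradient f y) b) = fun y => fderiv ℝ f y b :=
      funext fun y => inner_gradient_left
    have h4 := congrArg (fun φ => fderiv ℝ φ x a) h3
    beta_reduce at h4
    rw [fderiv_inner_apply ℝ h2 (differentiableAt_const b),
      fderiv_clm_apply h1 (differentiableAt_const b)] at h4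
    simpa using h4
  rw [real_inner_comm _ v, key, key, hsymm]

end PartialGradient

/-- Gradient of the upper-level loss via the minimizer approach. -/
theorem stmt_1 (P N : ℕ) (hP : 0 < P) (hN : 0 < N)
    (Φ : EuclideanSpace ℝ (Fin P) × EuclideanSpace ℝ (Fin N) → ℝ)
    (hΦ : ContDiff ℝ 2 Φ)
    (ℓ : EuclideanSpace ℝ (Fin P) × EuclideanSpace ℝ (Fin N) → ℝ)
    (hℓ : Differentiable ℝ ℓ)
    (xhat : EuclideanSpace ℝ (Fin P) → EuclideanSpace ℝ (Fin N))
    (hxhat : Differentiable ℝ xhat)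
    (hstat : ∀ γ : EuclideanSpace ℝ (Fin P),
      gradient (fun x => Φ (γ, x)) (xhat γ) = 0)
    (γ : EuclideanSpace ℝ (Fin P))
    (g : EuclideanSpace ℝ (Fin P) → EuclideanSpace ℝ (Fin N) → EuclideanSpace ℝ (Fin N))
    (hg : ∀ γ' x, g γ' x = gradient (fun x' => Φ (γ', x')) x)
    (e : EuclideanSpace ℝ (Fin N) ≃L[ℝ] EuclideanSpace ℝ (Fin N))
    (hH : fderiv ℝ (fun x => g γ x) (xhat γ) =
      (e : EuclideanSpace ℝ (Fin N) →L[ℝ] EuclideanSpace ℝ (Fin N))) :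
    gradient (fun γ' => ℓ (γ', xhat γ')) γ =
      gradient (fun γ' => ℓ (γ', xhat γ)) γ -
        (ContinuousLinearMap.adjoint (fderiv ℝ (fun γ' => g γ' (xhat γ)) γ))
          (e.symm (gradient (fun x => ℓ (γ, x)) (xhat γ))) := by
  obtain rfl : g = fun γ' x => gradient (fun x' => Φ (γ', x')) x := by
    funext γ' x; exact hg γ' x
  have he : ∀ v w, inner ℝ (e v) w = inner ℝ v (e w) := by
    have h := inner_fderiv_gradient_comm
      (hΦ.comp (contDiff_prodMk_right γ)) (xhat γ)
    intro v w
    have h' := h v w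
    change inner ℝ (fderiv ℝ (fun x => gradient (fun x' => Φ (γ, x')) x) (xhat γ) v) w =
      inner ℝ v (fderiv ℝ (fun x => gradient (fun x' => Φ (γ, x')) x) (xhat γ) w) at h'
    rwa [hH] at h'
  refine ext_inner_right ℝ fun v => ?_
  have himplicit := fderiv_comp_graph_apply
    (hΦ.differentiable_gradient_snd (γ, xhat γ)) (hxhat γ) v
  simp only [hstat, hH, fderiv_fun_const] at himplicit
  set J := fderiv ℝ (fun γ' => gradient (fun x' => Φ (γ', x')) (xhat γ)) γ
  have hD : e (fderiv ℝ xhat γ v) = -J v :=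
    eq_neg_of_add_eq_zero_right himplicit.symm
  rw [inner_gradient_left, fderiv_comp_graph_apply (hℓ _) (hxhat γ), inner_sub_left,
    inner_gradient_left, ContinuousLinearMap.adjoint_inner_left,
    sub_eq_add_neg, ← inner_neg_right, ← hD, ← he, e.apply_symm_apply,
    inner_gradient_left]
end

section
/- Derivative of the filtered-sparsity gradient term with respect to a filter coefficient: let f : ℝ → ℝ be differentiable, let x, c : ZMod N → ℝ, and let s : ZMod N. For h : ℝ let c_h := Function.update c s h, let z_h := c_h ⋆ x, and let c̃_h j := c_h (-j). Then for every i : ZMod N, the derivative at h = c s of the real-valued function h ↦ (c̃_h ⋆ (fun t => f (z_h t))) i equals f (z (i + s)) + (c̃ ⋆ (fun t => deriv f (z t) * x (t - s))) i, where z := c ⋆ x and c̃ j := c (-j); that is, the coefficient-wise gradient of c ↦ c̃ ⋆ f.(c ⋆ x) at coordinate s is the signal f.(circshift(c ⋆ x, s)) + c̃ ⋆ (f'.(c ⋆ x) ⊙ circshift(x, -s)). -/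
/-- Coordinatewise derivative of a circular convolution with respect to one filter coefficient. -/
theorem hasDerivAt_circulant_update_mulVec {N : ℕ} [NeZero N] (x c : ZMod N → ℝ)
    (s t : ZMod N) :
    HasDerivAt (fun h : ℝ => (Matrix.circulant (Function.update c s h)).mulVec x t)
      (x (t - s)) (c s) := by
  have key : HasDerivAt (fun h : ℝ => ∑ j, Function.update c s h (t - j) * x j)
      (∑ j, (Pi.single s (1 : ℝ) : ZMod N → ℝ) (t - j) * x j) (c s) :=
    HasDerivAt.fun_sum fun j _ =>
      (hasDerivAt_pi.1 (hasDerivAt_update c s (c s)) (t - j)).mul_const (x j)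
  refine key.congr_deriv ?_
  rw [Finset.sum_eq_single (t - s)]
  · simp
  · intro j _ hj
    rw [Pi.single_eq_of_ne (fun h => hj (by rw [← h, sub_sub_cancel])), zero_mul]
  · simp

/-- Derivative of the filtered-sparsity gradient term `c̃ ⋆ f.(c ⋆ x)` with respect
to the filter coefficient `c s`:  it equals
`f.(circshift(c ⋆ x, s)) + c̃ ⋆ (f'.(c ⋆ x) ⊙ circshift(x, -s))` at coordinate `i`.
Circular convolution is `(Matrix.circulant c).mulVec x`. -/
theorem stmt_3 {N : ℕ} [NeZero N] (f : ℝ → ℝ) (hf : Differentiable ℝ f)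
    (x c : ZMod N → ℝ) (s i : ZMod N) :
    HasDerivAt
      (fun h : ℝ =>
        (Matrix.circulant (fun j => Function.update c s h (-j))).mulVec
          (fun t => f ((Matrix.circulant (Function.update c s h)).mulVec x t)) i)
      (f ((Matrix.circulant c).mulVec x (i + s)) +
        (Matrix.circulant (fun j => c (-j))).mulVec
          (fun t => deriv f ((Matrix.circulant c).mulVec x t) * x (t - s)) i)
      (c s) := by
  have key : HasDerivAt (fun h : ℝ => ∑ t, Function.update c s h (-(i - t)) *
        f ((Matrix.circulant (Function.update c s h)).mulVec x t))
      (∑ t, ((Pi.single s (1 : ℝ) : ZMod N → ℝ) (-(i - t)) *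
          f ((Matrix.circulant c).mulVec x t) +
        c (-(i - t)) * (deriv f ((Matrix.circulant c).mulVec x t) * x (t - s)))) (c s) := by
    refine HasDerivAt.fun_sum fun t _ => ?_
    have hz := (hf _).hasDerivAt.comp (c s) (hasDerivAt_circulant_update_mulVec x c s t)
    have hc := hasDerivAt_pi.1 (hasDerivAt_update c s (c s)) (-(i - t))
    simpa only [Function.comp_apply, Function.comp_def, Function.update_eq_self]
      using hc.fun_mul hz
  refine key.congr_deriv ?_
  rw [Finset.sum_add_distrib]
  congr 1
  rw [Finset.sum_eq_single (i + s)]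
  · simp
  · intro t _ ht
    rw [Pi.single_eq_of_ne (fun h => ht (by rw [← h]; abel)), zero_mul]
  · simp
end

section
/- Strong convexity of the lower-level cost under a full-column-rank system matrix: if μ > 0 satisfies ‖A.mulVec v‖^2 ≥ μ * ‖v‖^2 for every v : EuclideanSpace ℝ (ZMod N) (in particular if A has full column rank and μ is the smallest eigenvalue of AᵀA), then the cost Φ is μ-strongly convex on the whole space; equivalently, x ↦ Φ(x) - (μ/2) * ‖x‖^2 is convex on Set.univ. -/
open Matrix

/-- The corner-rounded absolute value `t ↦ √(t² + ε²)` is convex. -/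
theorem convexOn_sqrt_sq_add_sq (ε : ℝ) :
    ConvexOn ℝ Set.univ (fun t : ℝ => Real.sqrt (t ^ 2 + ε ^ 2)) := by
  refine ⟨convex_univ, fun x _ y _ a b ha hb hab => ?_⟩
  simp only [smul_eq_mul]
  have hp := Real.sq_sqrt (show 0 ≤ x ^ 2 + ε ^ 2 by positivity)
  have hq := Real.sq_sqrt (show 0 ≤ y ^ 2 + ε ^ 2 by positivity)
  have hpq : x * y + ε ^ 2 ≤ √(x ^ 2 + ε ^ 2) * √(y ^ 2 + ε ^ 2) := by
    rw [← Real.sqrt_mul (by positivity)]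
    exact Real.le_sqrt_of_sq_le (by nlinarith [sq_nonneg (ε * (x - y))])
  refine Real.sqrt_le_iff.mpr ⟨by positivity, ?_⟩
  have hcross := mul_le_mul_of_nonneg_left hpq (mul_nonneg ha hb)
  obtain rfl : b = 1 - a := by linarith
  linear_combination 2 * hcross - a ^ 2 * hp - (1 - a) ^ 2 * hq

/-- A least-squares cost is `μ`-strongly convex when the linear map is bounded below by `√μ`. -/
theorem strongConvexOn_half_norm_sub_sq {E F : Type*} [NormedAddCommGroup E] [NormedSpace ℝ E]
    [NormedAddCommGroup F] [InnerProductSpace ℝ F] (L : E →ₗ[ℝ] F) (y : F) {μ : ℝ}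
    (hL : ∀ v, μ * ‖v‖ ^ 2 ≤ ‖L v‖ ^ 2) :
    StrongConvexOn Set.univ μ (fun x => (1 / 2) * ‖L x - y‖ ^ 2) := by
  refine ⟨convex_univ, fun u _ v _ a b ha hb hab => ?_⟩
  have hcomb : L (a • u + b • v) - y = a • (L u - y) + b • (L v - y) := by
    obtain rfl : b = 1 - a := by linarith
    rw [map_add, map_smul, map_smul]
    module
  have hdiff : L (u - v) = (L u - y) - (L v - y) := by
    rw [map_sub]
    abel
  have hbound := mul_le_mul_of_nonneg_left (hL (u - v)) (mul_nonneg ha hb)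
  rw [hdiff, norm_sub_sq_real (L u - y)] at hbound
  simp only [hcomb, norm_add_sq_real, norm_smul, inner_smul_left, inner_smul_right, smul_eq_mul,
    Real.norm_eq_abs, mul_pow, sq_abs, RCLike.conj_to_real]
  obtain rfl : b = 1 - a := by linarith
  linear_combination hbound / 2

/-- A finite sum of convex functions is convex. -/
theorem convexOn_finsetSum {E ι : Type*} [AddCommGroup E] [Module ℝ E] {s : Set E}
    (hs : Convex ℝ s) {t : Finset ι} {f : ι → E → ℝ} (hf : ∀ i ∈ t, ConvexOn ℝ s (f i)) :
    ConvexOn ℝ s (fun x => ∑ i ∈ t, f i x) := by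
  refine ⟨hs, fun x hx y hy a b ha hb hab => ?_⟩
  simp only [Finset.smul_sum, ← Finset.sum_add_distrib]
  exact Finset.sum_le_sum fun i hi => (hf i hi).2 hx hy ha hb hab

/-- A sum of corner-rounded absolute values of linear forms is convex. -/
theorem convexOn_sum_sqrt_sq_add_sq {E ι : Type*} [AddCommGroup E] [Module ℝ E] [Fintype ι]
    (l : ι → E →ₗ[ℝ] ℝ) (ε : ℝ) :
    ConvexOn ℝ Set.univ (fun x => ∑ i, Real.sqrt (l i x ^ 2 + ε ^ 2)) :=
  convexOn_finsetSum convex_univ fun i _ => (convexOn_sqrt_sq_add_sq ε).comp_linearMap (l i)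

/-- Strong convexity of the lower-level cost under a full-column-rank system
matrix: if `‖Av‖² ≥ μ ‖v‖²` for all `v` with `μ > 0`, then
`x ↦ Φ(x) - (μ/2)‖x‖²` is convex on the whole space. -/
theorem stmt_7 (M N K : ℕ) [NeZero N] (hM : 0 < M) (hK : 0 < K)
    (A : Matrix (Fin M) (ZMod N) ℝ) (y : EuclideanSpace ℝ (Fin M))
    (c : Fin K → ZMod N → ℝ) (β₀ : ℝ) (β : Fin K → ℝ) (ε : ℝ) (hε : 0 < ε)
    (Φ : EuclideanSpace ℝ (ZMod N) → ℝ)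
    (hΦdef : ∀ x, Φ x =
      (1/2) * ‖((WithLp.equiv 2 (Fin M → ℝ)).symm (A.mulVec x)) - y‖^2 +
        Real.exp β₀ * ∑ k, Real.exp (β k) *
          ∑ i, Real.sqrt ((((Matrix.circulant (c k)).mulVec x) i)^2 + ε^2))
    (μ : ℝ) (hμ : 0 < μ)
    (hA : ∀ v : EuclideanSpace ℝ (ZMod N),
      ‖((WithLp.equiv 2 (Fin M → ℝ)).symm (A.mulVec v))‖^2 ≥ μ * ‖v‖^2) :
    ConvexOn ℝ Set.univ (fun x : EuclideanSpace ℝ (ZMod N) => Φ x - (μ/2) * ‖x‖^2) := by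
  let L : EuclideanSpace ℝ (ZMod N) →ₗ[ℝ] EuclideanSpace ℝ (Fin M) := A.toLpLin 2 2
  let l (k : Fin K) (i : ZMod N) : EuclideanSpace ℝ (ZMod N) →ₗ[ℝ] ℝ :=
    LinearMap.proj i ∘ₗ (Matrix.circulant (c k)).mulVecLin ∘ₗ
      (WithLp.linearEquiv 2 ℝ (ZMod N → ℝ)).toLinearMap
  have hreg : ConvexOn ℝ Set.univ (fun x => Real.exp β₀ * ∑ k, Real.exp (β k) *
      ∑ i, Real.sqrt (l k i x ^ 2 + ε ^ 2)) :=
    (convexOn_finsetSum convex_univ fun k _ =>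
      (convexOn_sum_sqrt_sq_add_sq (l k) ε).smul (Real.exp_pos (β k)).le).smul (Real.exp_pos β₀).le
  have hfit := strongConvexOn_iff_convex.mp (strongConvexOn_half_norm_sub_sq L y hA)
  refine (hfit.add hreg).congr fun x _ => ?_
  rw [hΦdef x]
  exact sub_add_eq_add_sub _ _ _
end

section
/- Lipschitz constant of the gradient of the lower-level cost: for all x₁, x₂ : EuclideanSpace ℝ (ZMod N), ‖gradient Φ x₁ - gradient Φ x₂‖ ≤ L * ‖x₁ - x₂‖ with L = ‖A‖_op^2 + Real.exp β₀ * (1/ε) * ∑ k, Real.exp (β k) * (∑ j, |c k j|)^2, where ‖A‖_op is the operator norm of the linear map v ↦ A.mulVec v between the Euclidean spaces EuclideanSpace ℝ (ZMod N) and EuclideanSpace ℝ (Fin M). -/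
open Matrix

open scoped Gradient InnerProductSpace

theorem hasDerivAt_sqrt_sq_add_sq {ε : ℝ} (hε : 0 < ε) (z : ℝ) :
    HasDerivAt (fun t : ℝ => √(t ^ 2 + ε ^ 2)) (z / √(z ^ 2 + ε ^ 2)) z := by
  have hpos : 0 < z ^ 2 + ε ^ 2 := by positivity
  refine (((hasDerivAt_pow 2 z).add_const (ε ^ 2)).sqrt hpos.ne').congr_deriv ?_
  field_simp
  norm_num

theorem hasDerivAt_div_sqrt_sq_add_sq {ε : ℝ} (hε : 0 < ε) (z : ℝ) :
    HasDerivAt (fun t : ℝ => t / √(t ^ 2 + ε ^ 2)) (ε ^ 2 / √(z ^ 2 + ε ^ 2) ^ 3) z := by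
  have hs : 0 < √(z ^ 2 + ε ^ 2) := by positivity
  have hsq : √(z ^ 2 + ε ^ 2) ^ 2 = z ^ 2 + ε ^ 2 := Real.sq_sqrt (by positivity)
  refine ((hasDerivAt_id' z).div (hasDerivAt_sqrt_sq_add_sq hε z) hs.ne').congr_deriv ?_
  field_simp
  linarith

theorem abs_div_sqrt_sq_add_sq_sub_le {ε : ℝ} (hε : 0 < ε) (a b : ℝ) :
    |a / √(a ^ 2 + ε ^ 2) - b / √(b ^ 2 + ε ^ 2)| ≤ 1 / ε * |a - b| := by
  refine Convex.norm_image_sub_le_of_norm_hasDerivWithin_le (s := Set.univ)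
    (f := fun t : ℝ => t / √(t ^ 2 + ε ^ 2)) (f' := fun z => ε ^ 2 / √(z ^ 2 + ε ^ 2) ^ 3)
    (fun z _ => (hasDerivAt_div_sqrt_sq_add_sq hε z).hasDerivWithinAt) (fun z _ => ?_)
    convex_univ (Set.mem_univ b) (Set.mem_univ a)
  have hle : ε ≤ √(z ^ 2 + ε ^ 2) := Real.le_sqrt_of_sq_le (by nlinarith [sq_nonneg z])
  have h3 : ε ^ 3 ≤ √(z ^ 2 + ε ^ 2) ^ 3 := by gcongr
  rw [Real.norm_of_nonneg (by positivity), div_le_div_iff₀ (by positivity) hε]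
  linarith [pow_succ ε 2]

section Gradient

variable {E F : Type*} [NormedAddCommGroup E] [InnerProductSpace ℝ E] [CompleteSpace E]
  [NormedAddCommGroup F] [InnerProductSpace ℝ F] [CompleteSpace F]

theorem HasGradientAt.comp_continuousLinearMap {g : F → ℝ} {g' : F} (T : E →L[ℝ] F) {x : E}
    (hg : HasGradientAt g g' (T x)) :
    HasGradientAt (fun v => g (T v)) (T.adjoint g') x := by
  rw [hasGradientAt_iff_hasFDerivAt] at hg ⊢
  refine (hg.comp x T.hasFDerivAt).congr_fderiv ?_
  ext v
  simp [ContinuousLinearMap.adjoint_inner_left]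

theorem norm_adjoint_sub_adjoint_le (T : E →L[ℝ] F) {g : F → F} {C : ℝ}
    (hg : ∀ z w, ‖g z - g w‖ ≤ C * ‖z - w‖) (hC : 0 ≤ C) (x₁ x₂ : E) :
    ‖T.adjoint (g (T x₁)) - T.adjoint (g (T x₂))‖ ≤ ‖T‖ ^ 2 * C * ‖x₁ - x₂‖ := by
  rw [← map_sub]
  calc ‖T.adjoint (g (T x₁) - g (T x₂))‖
      ≤ ‖T.adjoint‖ * ‖g (T x₁) - g (T x₂)‖ := T.adjoint.le_opNorm _
    _ ≤ ‖T‖ * (C * ‖T (x₁ - x₂)‖) := by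
        rw [LinearIsometryEquiv.norm_map, map_sub]
        gcongr
        exact hg _ _
    _ ≤ ‖T‖ * (C * (‖T‖ * ‖x₁ - x₂‖)) := by
        gcongr
        exact T.le_opNorm _
    _ = ‖T‖ ^ 2 * C * ‖x₁ - x₂‖ := by ring

theorem hasGradientAt_half_norm_sub_sq (y z : F) :
    HasGradientAt (fun w => (1 / 2) * ‖w - y‖ ^ 2) (z - y) z := by
  rw [hasGradientAt_iff_hasFDerivAt]
  refine ((((hasFDerivAt_id z).sub_const y).norm_sq).const_mul (1 / 2 : ℝ)).congr_fderiv ?_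
  ext v
  simp

end Gradient

section EuclideanSpace

variable {ι : Type*} [Fintype ι]

theorem hasGradientAt_sum_sqrt_sq_add_sq {ε : ℝ} (hε : 0 < ε) (z : EuclideanSpace ℝ ι) :
    HasGradientAt (fun w : EuclideanSpace ℝ ι => ∑ i, √(w i ^ 2 + ε ^ 2))
      (WithLp.toLp 2 fun i => z i / √(z i ^ 2 + ε ^ 2)) z := by
  rw [hasGradientAt_iff_hasFDerivAt]
  have h (i : ι) := HasDerivAt.comp_hasFDerivAt (f := fun w : EuclideanSpace ℝ ι => w i) z
    (hasDerivAt_sqrt_sq_add_sq hε (z i))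
    (EuclideanSpace.proj i : EuclideanSpace ℝ ι →L[ℝ] ℝ).hasFDerivAt
  refine (HasFDerivAt.fun_sum (u := Finset.univ) fun i _ => h i).congr_fderiv ?_
  ext v
  simp [PiLp.inner_apply, mul_comm]

theorem norm_toLp_div_sqrt_sq_add_sq_sub_le {ε : ℝ} (hε : 0 < ε) (z w : EuclideanSpace ℝ ι) :
    ‖(WithLp.toLp 2 fun i => z i / √(z i ^ 2 + ε ^ 2) : EuclideanSpace ℝ ι)
      - WithLp.toLp 2 fun i => w i / √(w i ^ 2 + ε ^ 2)‖ ≤ 1 / ε * ‖z - w‖ := by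
  rw [← sq_le_sq₀ (norm_nonneg _) (by positivity), mul_pow, EuclideanSpace.norm_sq_eq,
    EuclideanSpace.norm_sq_eq, Finset.mul_sum]
  refine Finset.sum_le_sum fun i _ => ?_
  rw [← mul_pow]
  gcongr
  exact abs_div_sqrt_sq_add_sq_sub_le hε (z i) (w i)

theorem norm_toEuclideanLin_circulant_le [DecidableEq ι] [AddCommGroup ι] (c : ι → ℝ) :
    ‖(Matrix.toEuclideanLin (Matrix.circulant c)).toContinuousLinearMap‖ ≤ ∑ j, |c j| := by
  refine ContinuousLinearMap.opNorm_le_bound _ (by positivity) fun v => ?_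
  have h : (Matrix.toEuclideanLin (Matrix.circulant c)).toContinuousLinearMap v =
      ∑ j, c j • LinearIsometryEquiv.piLpCongrLeft 2 ℝ ℝ (Equiv.addRight j) v := by
    ext i
    simp only [LinearMap.coe_toContinuousLinearMap', Matrix.ofLp_toLpLin, Matrix.toLin'_apply,
      Matrix.mulVec, dotProduct, Matrix.circulant_apply, WithLp.ofLp_sum, Finset.sum_apply,
      WithLp.ofLp_smul, Pi.smul_apply, smul_eq_mul]
    rw [← (Equiv.subLeft i).sum_comp]
    refine Finset.sum_congr rfl fun j _ => ?_
    simp [Equiv.piCongrLeft', sub_eq_add_neg]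
  rw [h, Finset.sum_mul]
  refine (norm_sum_le _ _).trans_eq (Finset.sum_congr rfl fun j _ => ?_)
  rw [norm_smul, LinearIsometryEquiv.norm_map, Real.norm_eq_abs]

end EuclideanSpace

/-- Lipschitz constant of the gradient of the lower-level cost:
`‖∇Φ(x₁) - ∇Φ(x₂)‖ ≤ L ‖x₁ - x₂‖` with
`L = ‖A‖_op² + e^{β₀} (1/ε) ∑ₖ e^{βₖ} (∑ⱼ |cₖⱼ|)²`. -/
theorem stmt_8 (M N K : ℕ) [NeZero N] (hM : 0 < M) (hK : 0 < K)
    (A : Matrix (Fin M) (ZMod N) ℝ) (y : EuclideanSpace ℝ (Fin M))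
    (c : Fin K → ZMod N → ℝ) (β₀ : ℝ) (β : Fin K → ℝ) (ε : ℝ) (hε : 0 < ε)
    (Φ : EuclideanSpace ℝ (ZMod N) → ℝ)
    (hΦdef : ∀ x, Φ x =
      (1/2) * ‖((WithLp.equiv 2 (Fin M → ℝ)).symm (A.mulVec x)) - y‖^2 +
        Real.exp β₀ * ∑ k, Real.exp (β k) *
          ∑ i, Real.sqrt ((((Matrix.circulant (c k)).mulVec x) i)^2 + ε^2)) :
    ∀ x₁ x₂ : EuclideanSpace ℝ (ZMod N),
      ‖gradient Φ x₁ - gradient Φ x₂‖ ≤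
        (‖(Matrix.toEuclideanLin A).toContinuousLinearMap‖^2 +
          Real.exp β₀ * (1/ε) * ∑ k, Real.exp (β k) * (∑ j, |c k j|)^2) *
          ‖x₁ - x₂‖ := by
  intro x₁ x₂
  let T := (Matrix.toEuclideanLin A).toContinuousLinearMap
  let S (k : Fin K) := (Matrix.toEuclideanLin (Matrix.circulant (c k))).toContinuousLinearMap
  let r (z : EuclideanSpace ℝ (ZMod N)) : EuclideanSpace ℝ (ZMod N) :=
    WithLp.toLp 2 fun i => z i / √(z i ^ 2 + ε ^ 2)
  have hgrad : ∇ Φ = fun x => (T.adjoint (T x - y)) +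
      Real.exp β₀ • ∑ k, Real.exp (β k) • (S k).adjoint (r (S k x)) := by
    refine gradient_eq fun x => ?_
    have hT := ((hasGradientAt_half_norm_sub_sq y (T x)).comp_continuousLinearMap T).hasFDerivAt
    have hS (k : Fin K) :=
      ((hasGradientAt_sum_sqrt_sq_add_sq hε (S k x)).comp_continuousLinearMap (S k)).hasFDerivAt
    rw [hasGradientAt_iff_hasFDerivAt, funext hΦdef]
    refine (hT.add ((HasFDerivAt.fun_sum (u := Finset.univ)
      fun k _ => (hS k).const_mul (Real.exp (β k))).const_mul (Real.exp β₀))).congr_fderiv ?_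
    ext v
    simp [r]
  have hTle := norm_adjoint_sub_adjoint_le T (g := fun z => z - y) (C := 1) (by simp)
    zero_le_one x₁ x₂
  have hSle (k : Fin K) : ‖(S k).adjoint (r (S k x₁)) - (S k).adjoint (r (S k x₂))‖ ≤
      (∑ j, |c k j|) ^ 2 * (1 / ε) * ‖x₁ - x₂‖ := by
    refine (norm_adjoint_sub_adjoint_le (S k) (norm_toLp_div_sqrt_sq_add_sq_sub_le hε)
      (by positivity) x₁ x₂).trans ?_
    gcongr
    exact norm_toEuclideanLin_circulant_le (c k)
  rw [hgrad]
  simp only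
  rw [add_sub_add_comm, ← smul_sub, ← Finset.sum_sub_distrib]
  simp only [← smul_sub]
  calc _ ≤ ‖T.adjoint (T x₁ - y) - T.adjoint (T x₂ - y)‖ + Real.exp β₀ * ∑ k, Real.exp (β k) *
          ‖(S k).adjoint (r (S k x₁)) - (S k).adjoint (r (S k x₂))‖ := by
        refine (norm_add_le _ _).trans ?_
        rw [norm_smul, Real.norm_of_nonneg (Real.exp_pos β₀).le]
        gcongr
        refine (norm_sum_le _ _).trans_eq (Finset.sum_congr rfl fun k _ => ?_)
        rw [norm_smul, Real.norm_of_nonneg (Real.exp_pos _).le]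
    _ ≤ ‖T‖ ^ 2 * 1 * ‖x₁ - x₂‖ + Real.exp β₀ * ∑ k, Real.exp (β k) *
          ((∑ j, |c k j|) ^ 2 * (1 / ε) * ‖x₁ - x₂‖) := by
        gcongr with k
        exact hSle k
    _ = _ := by
        rw [mul_one, add_mul]
        congr 1
        simp only [Finset.mul_sum, Finset.sum_mul]
        exact Finset.sum_congr rfl fun k _ => by ring
end

section
/- Uniform bound on Hessian differences of the lower-level cost: for all x₁, x₂, u, v : EuclideanSpace ℝ (ZMod N), the second-derivative bilinear forms of Φ satisfy |iteratedFDeriv ℝ 2 Φ x₁ (u, v) - iteratedFDeriv ℝ 2 Φ x₂ (u, v)| ≤ Real.exp β₀ * (1/ε) * (∑ k, Real.exp (β k) * (∑ j, |c k j|)^2) * ‖u‖ * ‖v‖; in particular the data-fit contributions cancel and only the regularizer terms contribute. -/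
open Matrix

/-- Second derivative of a scalar function composed with a continuous linear functional. -/
theorem iteratedFDeriv_two_comp_clm {E : Type*} [NormedAddCommGroup E] [NormedSpace ℝ E]
    {g : ℝ → ℝ} (hg : ContDiff ℝ 2 g) (L : E →L[ℝ] ℝ) (x u v : E) :
    iteratedFDeriv ℝ 2 (fun x => g (L x)) x ![u, v] = L u * L v * iteratedDeriv 2 g (L x) := by
  have h := L.iteratedFDeriv_comp_right hg x (i := 2) le_rfl
  change iteratedFDeriv ℝ 2 (g ∘ L) x ![u, v] = _
  rw [h, ContinuousMultilinearMap.compContinuousLinearMap_apply,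
    iteratedFDeriv_apply_eq_iteratedDeriv_mul_prod]
  simp [Fin.prod_univ_two]

theorem contDiff_sqrt_sq_add_sq {ε : ℝ} (hε : 0 < ε) {n : WithTop ℕ∞} :
    ContDiff ℝ n (fun z : ℝ => Real.sqrt (z ^ 2 + ε ^ 2)) :=
  ContDiff.sqrt (by fun_prop) fun z => by positivity

theorem iteratedDeriv_two_sqrt_sq_add_sq {ε : ℝ} (hε : 0 < ε) (z : ℝ) :
    iteratedDeriv 2 (fun z : ℝ => Real.sqrt (z ^ 2 + ε ^ 2)) z =
      ε ^ 2 / Real.sqrt (z ^ 2 + ε ^ 2) ^ 3 := by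
  have hpos : ∀ z : ℝ, 0 < z ^ 2 + ε ^ 2 := fun z => by positivity
  have h1 : ∀ z : ℝ, HasDerivAt (fun z : ℝ => Real.sqrt (z ^ 2 + ε ^ 2))
      (z / Real.sqrt (z ^ 2 + ε ^ 2)) z := fun z => by
    have h := ((hasDerivAt_pow 2 z).add_const (ε ^ 2)).sqrt (hpos z).ne'
    refine h.congr_deriv ?_
    have := Real.sqrt_pos.2 (hpos z)
    field_simp
    simp [mul_comm]
  have h2 : HasDerivAt (fun z : ℝ => z / Real.sqrt (z ^ 2 + ε ^ 2))
      (ε ^ 2 / Real.sqrt (z ^ 2 + ε ^ 2) ^ 3) z := by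
    have hs := Real.sqrt_pos.2 (hpos z)
    refine ((hasDerivAt_id' z).fun_div (h1 z) hs.ne').congr_deriv ?_
    have hsq := Real.sq_sqrt (hpos z).le
    generalize Real.sqrt (z ^ 2 + ε ^ 2) = s at hs hsq
    field_simp
    linarith
  rw [iteratedDeriv_succ, iteratedDeriv_one, funext fun z => (h1 z).deriv]
  exact h2.deriv

theorem iteratedDeriv_two_sqrt_sq_add_sq_mem_Icc {ε : ℝ} (hε : 0 < ε) (z : ℝ) :
    iteratedDeriv 2 (fun z : ℝ => Real.sqrt (z ^ 2 + ε ^ 2)) z ∈ Set.Icc 0 (1 / ε) := by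
  rw [iteratedDeriv_two_sqrt_sq_add_sq hε]
  refine ⟨by positivity, ?_⟩
  have h : ε ≤ Real.sqrt (z ^ 2 + ε ^ 2) := Real.le_sqrt_of_sq_le (by nlinarith [sq_nonneg z])
  calc ε ^ 2 / Real.sqrt (z ^ 2 + ε ^ 2) ^ 3 ≤ ε ^ 2 / ε ^ 3 := by gcongr
    _ = 1 / ε := by field_simp

/-- Young's inequality for circulant matrices acting on the Euclidean space. -/
theorem norm_circulant_mulVec_le {G : Type*} [Fintype G] [AddCommGroup G] (c : G → ℝ)
    (u : EuclideanSpace ℝ G) :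
    ‖(WithLp.toLp 2 ((circulant c).mulVec u) : EuclideanSpace ℝ G)‖ ≤ (∑ j, |c j|) * ‖u‖ := by
  have h : (WithLp.toLp 2 ((circulant c).mulVec u) : EuclideanSpace ℝ G) =
      ∑ m, c m • (WithLp.toLp 2 (fun i => u (i - m)) : EuclideanSpace ℝ G) := by
    ext i
    simp only [mulVec, dotProduct, circulant_apply, WithLp.ofLp_sum, WithLp.ofLp_smul,
      Finset.sum_apply, Pi.smul_apply, smul_eq_mul]
    exact Fintype.sum_equiv (Equiv.subLeft i) _ _ fun j => by simp
  have hshift : ∀ m, ‖(WithLp.toLp 2 (fun i => u (i - m)) : EuclideanSpace ℝ G)‖ = ‖u‖ := by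
    intro m
    rw [EuclideanSpace.norm_eq, EuclideanSpace.norm_eq]
    congr 1
    exact Fintype.sum_equiv (Equiv.subRight m) _ _ fun j => by simp
  rw [h, Finset.sum_mul]
  refine (norm_sum_le _ _).trans (le_of_eq ?_)
  simp only [norm_smul, hshift, Real.norm_eq_abs]

theorem sum_abs_mul_abs_le_norm_mul_norm {ι : Type*} [Fintype ι] (a b : EuclideanSpace ℝ ι) :
    ∑ i, |a i| * |b i| ≤ ‖a‖ * ‖b‖ := by
  rw [EuclideanSpace.norm_eq, EuclideanSpace.norm_eq]
  exact Real.sum_mul_le_sqrt_mul_sqrt _ _ _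

/-- The functional `x ↦ (B x) i` on the Euclidean space. -/
noncomputable def Matrix.rowCLM {m n : Type*} [Fintype n]
    (B : Matrix m n ℝ) (i : m) : EuclideanSpace ℝ n →L[ℝ] ℝ :=
  ∑ j, B i j • EuclideanSpace.proj j

theorem Matrix.rowCLM_apply {m n : Type*} [Fintype n]
    (B : Matrix m n ℝ) (i : m) (x : EuclideanSpace ℝ n) : B.rowCLM i x = B.mulVec x i := by
  simp [Matrix.rowCLM, mulVec, dotProduct]

theorem iteratedFDeriv_two_dataFit_add_regularizer {M N K : ℕ} [NeZero N]
    (A : Matrix (Fin M) (ZMod N) ℝ) (y : EuclideanSpace ℝ (Fin M))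
    (C : Fin K → Matrix (ZMod N) (ZMod N) ℝ) (b : ℝ) (w : Fin K → ℝ) {g : ℝ → ℝ}
    (hg : ContDiff ℝ 2 g) (x u v : EuclideanSpace ℝ (ZMod N)) :
    iteratedFDeriv ℝ 2 (fun x : EuclideanSpace ℝ (ZMod N) =>
        (1/2) * ‖((WithLp.equiv 2 (Fin M → ℝ)).symm (A.mulVec x)) - y‖^2 +
          b * ∑ k, w k * ∑ i, g (((C k).mulVec x) i)) x ![u, v] =
      ∑ i, A.mulVec u i * A.mulVec v i +
        b * ∑ k, w k * ∑ i, (C k).mulVec u i * (C k).mulVec v i *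
          iteratedDeriv 2 g ((C k).mulVec x i) := by
  have hq : ∀ i, ContDiff ℝ 2 (fun t : ℝ => (1/2) * (t - y i) ^ 2) := fun i => by fun_prop
  have hq2 : ∀ i t, iteratedDeriv 2 (fun t : ℝ => (1/2) * (t - y i) ^ 2) t = 1 := by
    intro i t
    have h1 : deriv (fun t : ℝ => (1/2) * (t - y i) ^ 2) = fun t => t - y i := by
      ext t
      have := (((hasDerivAt_id t).sub_const (y i)).pow 2).const_mul (1/2)
      refine HasDerivAt.deriv (this.congr_deriv ?_)
      simp
    rw [iteratedDeriv_succ, iteratedDeriv_one, h1]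
    simp
  have hfun : (fun x : EuclideanSpace ℝ (ZMod N) =>
        (1/2) * ‖((WithLp.equiv 2 (Fin M → ℝ)).symm (A.mulVec x)) - y‖^2 +
          b * ∑ k, w k * ∑ i, g (((C k).mulVec x) i)) =
      (fun x => ∑ i, (1/2) * (A.rowCLM i x - y i) ^ 2) +
        b • fun x => ∑ k, (w k • fun x => ∑ i, g ((C k).rowCLM i x)) x := by
    ext x
    simp [Matrix.rowCLM_apply, EuclideanSpace.norm_sq_eq, Finset.mul_sum]
  have hA : ∀ i, ContDiff ℝ 2 (fun x => (1/2) * (A.rowCLM i x - y i) ^ 2) :=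
    fun i => by fun_prop
  have hC : ∀ k i, ContDiff ℝ 2 (fun x => g ((C k).rowCLM i x)) :=
    fun k i => hg.comp ((C k).rowCLM i).contDiff
  have hCs : ∀ k, ContDiff ℝ 2 (fun x => ∑ i, g ((C k).rowCLM i x)) :=
    fun k => ContDiff.sum fun i _ => hC k i
  have hCw : ∀ k, ContDiff ℝ 2 (w k • fun x => ∑ i, g ((C k).rowCLM i x)) :=
    fun k => (hCs k).const_smul (w k)
  have hR : ContDiff ℝ 2 (fun x => ∑ k, (w k • fun x => ∑ i, g ((C k).rowCLM i x)) x) :=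
    ContDiff.sum fun k _ => hCw k
  have hRb : ContDiff ℝ 2
      (b • fun x => ∑ k, (w k • fun x => ∑ i, g ((C k).rowCLM i x)) x) := hR.const_smul b
  have hA' : ∀ i, iteratedFDeriv ℝ 2 (fun x => (1/2) * (A.rowCLM i x - y i) ^ 2) x ![u, v] =
      A.mulVec u i * A.mulVec v i := fun i => by
    rw [iteratedFDeriv_two_comp_clm (hq i), hq2, mul_one, Matrix.rowCLM_apply,
      Matrix.rowCLM_apply]
  have hC' : ∀ k, iteratedFDeriv ℝ 2 (w k • fun x => ∑ i, g ((C k).rowCLM i x)) x ![u, v] =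
      w k * ∑ i, (C k).mulVec u i * (C k).mulVec v i *
        iteratedDeriv 2 g ((C k).mulVec x i) := fun k => by
    rw [iteratedFDeriv_const_smul_apply (hCs k).contDiffAt,
      iteratedFDeriv_fun_sum_apply fun i _ => (hC k i).contDiffAt, _root_.smul_apply,
      _root_.sum_apply, smul_eq_mul]
    simp_rw [iteratedFDeriv_two_comp_clm hg, Matrix.rowCLM_apply]
  rw [hfun, iteratedFDeriv_add_apply (ContDiff.sum fun i _ => hA i).contDiffAt hRb.contDiffAt,
    iteratedFDeriv_const_smul_apply hR.contDiffAt,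
    iteratedFDeriv_fun_sum_apply fun i _ => (hA i).contDiffAt,
    iteratedFDeriv_fun_sum_apply fun k _ => (hCw k).contDiffAt,
    _root_.add_apply, _root_.smul_apply, _root_.sum_apply, _root_.sum_apply, smul_eq_mul]
  simp only [hA', hC']

theorem abs_sum_mul_sub_le {G : Type*} [Fintype G] [AddCommGroup G] (c : G → ℝ)
    {h : ℝ → ℝ} {B : ℝ} (hh : ∀ z, h z ∈ Set.Icc 0 B) (p q : G → ℝ) (u v : EuclideanSpace ℝ G) :
    |∑ i, (circulant c).mulVec u i * (circulant c).mulVec v i * (h (p i) - h (q i))| ≤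
      B * ((∑ j, |c j|) ^ 2 * ‖u‖ * ‖v‖) := by
  have hB : 0 ≤ B := (hh 0).1.trans (hh 0).2
  have hd : ∀ i, |h (p i) - h (q i)| ≤ B := fun i =>
    abs_sub_le_iff.2 ⟨by linarith [(hh (p i)).2, (hh (q i)).1],
      by linarith [(hh (p i)).1, (hh (q i)).2]⟩
  calc _ ≤ ∑ i, |(circulant c).mulVec u i| * |(circulant c).mulVec v i| * B := by
        refine (Finset.abs_sum_le_sum_abs _ _).trans (Finset.sum_le_sum fun i _ => ?_)
        rw [abs_mul, abs_mul]
        exact mul_le_mul_of_nonneg_left (hd i) (by positivity)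
    _ = B * ∑ i, |(circulant c).mulVec u i| * |(circulant c).mulVec v i| := by
        rw [← Finset.sum_mul, mul_comm]
    _ ≤ B * (((∑ j, |c j|) * ‖u‖) * ((∑ j, |c j|) * ‖v‖)) := by
        refine mul_le_mul_of_nonneg_left ?_ hB
        refine (sum_abs_mul_abs_le_norm_mul_norm (WithLp.toLp 2 ((circulant c).mulVec u))
          (WithLp.toLp 2 ((circulant c).mulVec v))).trans ?_
        exact mul_le_mul (norm_circulant_mulVec_le c u) (norm_circulant_mulVec_le c v)
          (norm_nonneg _) (by positivity)
    _ = _ := by ring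

/-- Uniform bound on Hessian differences of the lower-level cost: for all
`x₁, x₂, u, v`,
`|∇²Φ(x₁)(u,v) - ∇²Φ(x₂)(u,v)| ≤ e^{β₀} (1/ε) (∑ₖ e^{βₖ} (∑ⱼ |cₖⱼ|)²) ‖u‖ ‖v‖`. -/
theorem stmt_9 (M N K : ℕ) [NeZero N] (hM : 0 < M) (hK : 0 < K)
    (A : Matrix (Fin M) (ZMod N) ℝ) (y : EuclideanSpace ℝ (Fin M))
    (c : Fin K → ZMod N → ℝ) (β₀ : ℝ) (β : Fin K → ℝ) (ε : ℝ) (hε : 0 < ε)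
    (Φ : EuclideanSpace ℝ (ZMod N) → ℝ)
    (hΦdef : ∀ x, Φ x =
      (1/2) * ‖((WithLp.equiv 2 (Fin M → ℝ)).symm (A.mulVec x)) - y‖^2 +
        Real.exp β₀ * ∑ k, Real.exp (β k) *
          ∑ i, Real.sqrt ((((Matrix.circulant (c k)).mulVec x) i)^2 + ε^2)) :
    ∀ x₁ x₂ u v : EuclideanSpace ℝ (ZMod N),
      |iteratedFDeriv ℝ 2 Φ x₁ ![u, v] - iteratedFDeriv ℝ 2 Φ x₂ ![u, v]| ≤
        Real.exp β₀ * (1/ε) * (∑ k, Real.exp (β k) * (∑ j, |c k j|)^2) * ‖u‖ * ‖v‖ := by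
  intro x₁ x₂ u v
  have hg := contDiff_sqrt_sq_add_sq hε (n := 2)
  rw [funext hΦdef, iteratedFDeriv_two_dataFit_add_regularizer A y _ _ _ hg,
    iteratedFDeriv_two_dataFit_add_regularizer A y _ _ _ hg, add_sub_add_left_eq_sub, ← mul_sub,
    ← Finset.sum_sub_distrib, abs_mul, abs_of_pos (Real.exp_pos _)]
  simp only [← mul_sub, ← Finset.sum_sub_distrib]
  rw [mul_assoc, mul_assoc, mul_assoc]
  refine mul_le_mul_of_nonneg_left ?_ (Real.exp_pos _).le
  rw [Finset.sum_mul, Finset.mul_sum]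
  refine (Finset.abs_sum_le_sum_abs _ _).trans (Finset.sum_le_sum fun k _ => ?_)
  rw [abs_mul, abs_of_pos (Real.exp_pos _)]
  refine (mul_le_mul_of_nonneg_left (abs_sum_mul_sub_le (c k)
    (iteratedDeriv_two_sqrt_sq_add_sq_mem_Icc hε) _ _ u v) (Real.exp_pos _).le).trans (le_of_eq ?_)
  ring
end

section
/- Eigenpairs of a circulant matrix are discrete Fourier vectors: let N be a positive natural number, c : ZMod N → ℂ a filter, ζ := Complex.exp (2 * π * Complex.I / N), and m : ZMod N. Define v : ZMod N → ℂ by v k = ζ ^ (k.val * m.val) and λ := ∑ j : ZMod N, c j * ζ ^ (-(j.val * m.val : ℤ)). Then (Matrix.circulant c).mulVec v = λ • v; i.e. the eigenvalues of the circulant matrix are the values of the discrete Fourier transform of its first column. -/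
/-- Integer powers of `exp(2πi/N)` are values of the standard additive character of `ZMod N`. -/
lemma exp_two_pi_I_div_zpow_eq_stdAddChar (N : ℕ) [NeZero N] (z : ℤ) :
    Complex.exp (2 * (Real.pi : ℂ) * Complex.I / (N : ℂ)) ^ z = ZMod.stdAddChar (z : ZMod N) := by
  rw [ZMod.stdAddChar_coe, ← Complex.exp_int_mul]
  ring_nf

/-- Eigenpairs of a circulant matrix are discrete Fourier vectors: with
`ζ = exp(2πi/N)`, `v k = ζ^(k.val * m.val)` and
`λ = ∑ⱼ cⱼ ζ^(-(j.val * m.val))`, one has `(circulant c).mulVec v = λ • v`. -/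
theorem stmt_16 (N : ℕ) [NeZero N] (c : ZMod N → ℂ) (m : ZMod N) :
    (Matrix.circulant c).mulVec
        (fun k : ZMod N => Complex.exp (2 * (Real.pi : ℂ) * Complex.I / (N : ℂ)) ^ (k.val * m.val)) =
      (∑ j : ZMod N, c j *
          Complex.exp (2 * (Real.pi : ℂ) * Complex.I / (N : ℂ)) ^ (-((j.val * m.val : ℕ) : ℤ))) •
        (fun k : ZMod N => Complex.exp (2 * (Real.pi : ℂ) * Complex.I / (N : ℂ)) ^ (k.val * m.val)) := by
  have hpow (k : ZMod N) :
      Complex.exp (2 * (Real.pi : ℂ) * Complex.I / (N : ℂ)) ^ (k.val * m.val) =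
        ZMod.stdAddChar (k * m) := by
    rw [← zpow_natCast, exp_two_pi_I_div_zpow_eq_stdAddChar]
    simp
  have hneg (j : ZMod N) :
      Complex.exp (2 * (Real.pi : ℂ) * Complex.I / (N : ℂ)) ^ (-((j.val * m.val : ℕ) : ℤ)) =
        ZMod.stdAddChar (-(j * m)) := by
    rw [exp_two_pi_I_div_zpow_eq_stdAddChar]
    simp
  simp only [hpow, hneg]
  ext i
  simp only [Matrix.mulVec, dotProduct, Matrix.circulant_apply, Pi.smul_apply, smul_eq_mul,
    Finset.sum_mul]
  refine Fintype.sum_equiv (Equiv.subLeft i) _ _ fun k => ?_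
  rw [Equiv.subLeft_apply, mul_assoc, ← AddChar.map_add_eq_mul]
  ring_nf
end
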